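/- The bijection ε(F) := F ∩ E from the set of idempotent proper filters of S to the set of E-filters is a homeomorphism, where the set of idempotent proper filters carries the subspace topology induced by the patch topology on proper filters of S, and the set of E-filters carries its patch topology. -/

import Mathlib

/-- An inverse semigroup with zero: every element `a` has a unique `a⁻¹` with
`a * a⁻¹ * a = a` and `a⁻¹ * a * a⁻¹ = a⁻¹`, and `0` is absorbing. -/
class InvSemigroupWithZero (S : Type*) extends Semigroup S, Zero S, Inv S where
  mul_inv_mul : ∀ a : S, a * a⁻¹ * a = a
  inv_mul_inv : ∀ a : S, a⁻¹ * a * a⁻¹ = a⁻¹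
  inv_unique : ∀ a b : S, a * b * a = a → b * a * b = b → b = a⁻¹
  zero_mul : ∀ a : S, 0 * a = 0
  mul_zero : ∀ a : S, a * 0 = 0

namespace InvSemigroupWithZero

variable {S : Type*} [InvSemigroupWithZero S]

/-- The natural partial order on `S`: `a ≤ b` iff `a = a * a⁻¹ * b`. -/
def sle (a b : S) : Prop := a = a * a⁻¹ * b

/-- `↓s`, the down-set of `s` w.r.t. the natural partial order. -/
def dwn (s : S) : Set S := {t : S | sle t s}

/-- `↑A`, the up-set generated by `A` w.r.t. the natural partial order. -/
def up (A : Set S) : Set S := {b : S | ∃ a ∈ A, sle a b}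

/-- A filter in `S`: a nonempty down-directed up-set. -/
def IsFilt (F : Set S) : Prop :=
  F.Nonempty ∧ up F = F ∧ ∀ a ∈ F, ∀ b ∈ F, ∃ c ∈ F, sle c a ∧ sle c b

/-- A proper filter: a filter not containing `0`. -/
def IsPFilt (F : Set S) : Prop := IsFilt F ∧ (0 : S) ∉ F

/-- An ultrafilter: a proper filter maximal among proper filters. -/
def IsUltra (U : Set S) : Prop :=
  IsPFilt U ∧ ∀ G : Set S, IsPFilt G → U ⊆ G → U = G

/-- The set `E` of idempotents of `S`. -/
def E (S : Type*) [InvSemigroupWithZero S] : Set S := {e : S | e * e = e}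

/-- `F⁻¹ = {a⁻¹ : a ∈ F}`. -/
def finv (F : Set S) : Set S := (fun a : S => a⁻¹) '' F

/-- `F · G = ↑{fg : f ∈ F, g ∈ G}`. -/
def fmul (F G : Set S) : Set S := up (Set.image2 (· * ·) F G)

/-- The source `d(F) := F⁻¹ · F`. -/
def src (F : Set S) : Set S := fmul (finv F) F

/-- The range `r(F) := F · F⁻¹`. -/
def rng (F : Set S) : Set S := fmul F (finv F)

/-- The natural partial order on the idempotents: `e ≤ f` iff `e = e * f`. -/
def ele (e f : S) : Prop := e = e * f

/-- The down-set of an idempotent `e` inside `E`. -/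
def edwn (e : S) : Set S := {f : S | f ∈ E S ∧ ele f e}

/-- The up-set generated by `A` inside `E`. -/
def eup (A : Set S) : Set S := {f : S | f ∈ E S ∧ ∃ a ∈ A, ele a f}

/-- An `E`-filter: a proper filter of the inverse semigroup `E` of idempotents. -/
def IsEFilt (ξ : Set S) : Prop :=
  ξ ⊆ E S ∧ ξ.Nonempty ∧ eup ξ = ξ ∧
    (∀ a ∈ ξ, ∀ b ∈ ξ, ∃ c ∈ ξ, ele c a ∧ ele c b) ∧ (0 : S) ∉ ξ

/-- An `E`-ultrafilter: an `E`-filter maximal among `E`-filters. -/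
def IsEUltra (ξ : Set S) : Prop :=
  IsEFilt ξ ∧ ∀ η : Set S, IsEFilt η → ξ ⊆ η → ξ = η

/-- `β_s(ξ) = {f ∈ E : s·e·s⁻¹ ≤ f for some e ∈ ξ}`. -/
def beta (s : S) (ξ : Set S) : Set S :=
  {f : S | f ∈ E S ∧ ∃ e ∈ ξ, sle (s * e * s⁻¹) f}

/-- The set of proper filters in `S`. -/
abbrev PFilt (S : Type*) [InvSemigroupWithZero S] := {F : Set S // IsPFilt F}

/-- The patch topology on the set of proper filters, generated by the sets
`F(s;T) = {F : s ∈ F, F ∩ T = ∅}` for `s ∈ S` and finite `T ⊆ ↓s`. -/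
instance patchTopology : TopologicalSpace (PFilt S) :=
  TopologicalSpace.generateFrom
    {O : Set (PFilt S) | ∃ (s : S) (T : Set S), T.Finite ∧ T ⊆ dwn s ∧
      O = {F : PFilt S | s ∈ F.1 ∧ F.1 ∩ T = ∅}}

/-- The set of idempotent proper filters in `S`. -/
abbrev IPFilt (S : Type*) [InvSemigroupWithZero S] :=
  {F : Set S // IsPFilt F ∧ (F ∩ E S).Nonempty}

/-- The subspace topology induced by the patch topology on proper filters. -/
instance : TopologicalSpace (IPFilt S) :=
  TopologicalSpace.induced (fun F => (⟨F.1, F.2.1⟩ : PFilt S)) inferInstance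

/-- The set of `E`-filters. -/
abbrev EFilt (S : Type*) [InvSemigroupWithZero S] := {ξ : Set S // IsEFilt ξ}

/-- The patch topology on the set of `E`-filters, generated by the sets
`P(e;X) = {ξ : e ∈ ξ, ξ ∩ X = ∅}` for `e ∈ E` and finite `X ⊆ ↓e ∩ E`. -/
instance : TopologicalSpace (EFilt S) :=
  TopologicalSpace.generateFrom
    {O : Set (EFilt S) | ∃ (e : S) (X : Set S), e ∈ E S ∧ X.Finite ∧ X ⊆ edwn e ∧
      O = {ξ : EFilt S | e ∈ ξ.1 ∧ ξ.1 ∩ X = ∅}}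

/-- The set of ultrafilters in `S`. -/
abbrev UFilt (S : Type*) [InvSemigroupWithZero S] := {U : Set S // IsUltra U}

/-- The subspace topology induced by the patch topology on proper filters. -/
instance : TopologicalSpace (UFilt S) :=
  TopologicalSpace.induced (fun U => (⟨U.1, U.2.1⟩ : PFilt S)) inferInstance

end InvSemigroupWithZero

open InvSemigroupWithZero

namespace InvSemigroupWithZero

section

variable {S : Type*} [InvSemigroupWithZero S]

theorem inv_eq_self_of_mem_E {e : S} (he : e ∈ E S) : e⁻¹ = e := by
  have h : e * e = e := he
  exact (inv_unique e e (by rw [h, h]) (by rw [h, h])).symm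

theorem mul_inv_mem_E (a : S) : a * a⁻¹ ∈ E S := by
  change a * a⁻¹ * (a * a⁻¹) = a * a⁻¹
  rw [← mul_assoc, mul_inv_mul]

theorem mul_mem_E {e f : S} (he : e ∈ E S) (hf : f ∈ E S) : e * f ∈ E S := by
  have he' : ∀ z, e * (e * z) = e * z := fun z => by rw [← mul_assoc, show e * e = e from he]
  have hf' : ∀ z, f * (f * z) = f * z := fun z => by rw [← mul_assoc, show f * f = f from hf]
  have h1 := mul_inv_mul (e * f)
  have h2 := inv_mul_inv (e * f)
  have h3 := inv_unique (e * f) (f * (e * f)⁻¹ * e)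
  generalize (e * f)⁻¹ = x at h1 h2 h3
  have h2' : ∀ z, x * (e * (f * (x * z))) = x * z := fun z => by
    simpa only [mul_assoc] using congrArg (· * z) h2
  simp only [mul_assoc] at h1 h2 h3
  have hx : f * (x * e) = x := by
    apply h3
    · simp only [he', hf', h1]
    · simp only [he', hf', h2']
  have hxx : x * x = x := by
    have : f * (x * e) * (f * (x * e)) = f * (x * e) := by simp only [mul_assoc, h2']
    rwa [hx] at this
  have hef : e * f = x := by
    rw [← inv_eq_self_of_mem_E (show x ∈ E S from hxx)]
    apply inv_unique <;> simp only [mul_assoc, h1, h2]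
  rw [hef]
  exact hxx

theorem mul_comm_of_mem_E {e f : S} (he : e ∈ E S) (hf : f ∈ E S) : e * f = f * e := by
  have he' : ∀ z, e * (e * z) = e * z := fun z => by rw [← mul_assoc, show e * e = e from he]
  have hf' : ∀ z, f * (f * z) = f * z := fun z => by rw [← mul_assoc, show f * f = f from hf]
  have h1 : e * f * (e * f) = e * f := mul_mem_E he hf
  have h2 : f * e * (f * e) = f * e := mul_mem_E hf he
  rw [← inv_eq_self_of_mem_E (mul_mem_E he hf)]
  symm
  apply inv_unique
  · simpa only [mul_assoc, he', hf'] using h1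
  · simpa only [mul_assoc, he', hf'] using h2

theorem sle_iff_of_mem_E {e : S} (he : e ∈ E S) (b : S) : sle e b ↔ e = e * b := by
  rw [sle, inv_eq_self_of_mem_E he, show e * e = e from he]

theorem sle_refl (a : S) : sle a a := (mul_inv_mul a).symm

theorem sle_trans {a b c : S} (hab : sle a b) (hbc : sle b c) : sle a c := by
  have hcomm := mul_comm_of_mem_E (mul_inv_mem_E a) (mul_inv_mem_E b)
  have hba : b * b⁻¹ * a = a := by
    conv_lhs => rw [show a = a * a⁻¹ * b from hab]
    rw [← mul_assoc, ← hcomm, mul_assoc (a * a⁻¹), mul_inv_mul]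
    exact hab.symm
  have hidem : a * a⁻¹ * (b * b⁻¹) = a * a⁻¹ := by
    rw [hcomm, ← mul_assoc, hba]
  have hbc' : b = b * b⁻¹ * c := hbc
  calc a = a * a⁻¹ * (b * b⁻¹ * c) := by rw [← hbc']; exact hab
    _ = a * a⁻¹ * c := by rw [← mul_assoc, hidem]

theorem mem_E_of_sle {a e : S} (h : sle a e) (he : e ∈ E S) : a ∈ E S := by
  rw [show a = a * a⁻¹ * e from h]
  exact mul_mem_E (mul_inv_mem_E a) he

theorem eq_zero_of_sle_zero {a : S} (h : sle a 0) : a = 0 := by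
  rw [show a = a * a⁻¹ * 0 from h, InvSemigroupWithZero.mul_zero]

theorem IsFilt.mem_of_sle {F : Set S} (hF : IsFilt F) {a b : S} (ha : a ∈ F) (h : sle a b) :
    b ∈ F := by
  rw [← hF.2.1]
  exact ⟨a, ha, h⟩

theorem IsEFilt.mem_of_ele {ξ : Set S} (hξ : IsEFilt ξ) {a b : S} (ha : a ∈ ξ) (hb : b ∈ E S)
    (h : ele a b) : b ∈ ξ := by
  rw [← hξ.2.2.1]
  exact ⟨hb, a, ha, h⟩

theorem IsPFilt.isEFilt_inter_E {F : Set S} (hF : IsPFilt F) (hne : (F ∩ E S).Nonempty) :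
    IsEFilt (F ∩ E S) := by
  refine ⟨Set.inter_subset_right, hne, ?_, ?_, fun h => hF.2 h.1⟩
  · ext f
    constructor
    · rintro ⟨hf, a, ha, haf⟩
      exact ⟨hF.1.mem_of_sle ha.1 ((sle_iff_of_mem_E ha.2 f).2 haf), hf⟩
    · intro hf
      exact ⟨hf.2, f, hf, hf.2.symm⟩
  · intro a ha b hb
    obtain ⟨c, hc, hca, hcb⟩ := hF.1.2.2 a ha.1 b hb.1
    have hcE := mem_E_of_sle hca ha.2
    exact ⟨c, ⟨hc, hcE⟩, (sle_iff_of_mem_E hcE a).1 hca, (sle_iff_of_mem_E hcE b).1 hcb⟩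

theorem subset_up (A : Set S) : A ⊆ up A := fun a ha => ⟨a, ha, sle_refl a⟩

theorem IsEFilt.isPFilt_up {ξ : Set S} (hξ : IsEFilt ξ) : IsPFilt (up ξ) := by
  obtain ⟨hE, hne, -, hdir, h0⟩ := hξ
  refine ⟨⟨hne.mono (subset_up ξ), ?_, ?_⟩, ?_⟩
  · refine Set.Subset.antisymm ?_ (subset_up _)
    rintro b ⟨a, ⟨e, he, hea⟩, hab⟩
    exact ⟨e, he, sle_trans hea hab⟩
  · rintro a ⟨e, he, hea⟩ b ⟨f, hf, hfb⟩
    obtain ⟨c, hc, hce, hcf⟩ := hdir e he f hf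
    exact ⟨c, subset_up ξ hc, sle_trans ((sle_iff_of_mem_E (hE hc) e).2 hce) hea,
      sle_trans ((sle_iff_of_mem_E (hE hc) f).2 hcf) hfb⟩
  · rintro ⟨e, he, he0⟩
    exact h0 (eq_zero_of_sle_zero he0 ▸ he)

theorem IsEFilt.up_inter_E {ξ : Set S} (hξ : IsEFilt ξ) : up ξ ∩ E S = ξ := by
  refine Set.Subset.antisymm ?_ fun e he => ⟨subset_up ξ he, hξ.1 he⟩
  rintro f ⟨⟨e, he, hef⟩, hf⟩
  exact hξ.mem_of_ele he hf ((sle_iff_of_mem_E (hξ.1 he) f).1 hef)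

theorem IsPFilt.up_inter_E {F : Set S} (hF : IsPFilt F) (hne : (F ∩ E S).Nonempty) :
    up (F ∩ E S) = F := by
  refine Set.Subset.antisymm ?_ ?_
  · rintro b ⟨a, ha, hab⟩
    exact hF.1.mem_of_sle ha.1 hab
  · intro s hs
    obtain ⟨e, he⟩ := hne
    obtain ⟨c, hc, hcs, hce⟩ := hF.1.2.2 s hs e he.1
    exact ⟨c, ⟨hc, mem_E_of_sle hce he.2⟩, hcs⟩

/-- The bijection `F ↦ F ∩ E` between idempotent proper filters and `E`-filters, with inverse
`ξ ↦ ↑ξ`. -/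
def idempotentFilterEquiv (S : Type*) [InvSemigroupWithZero S] : IPFilt S ≃ EFilt S where
  toFun F := ⟨F.1 ∩ E S, F.2.1.isEFilt_inter_E F.2.2⟩
  invFun ξ := ⟨up ξ.1, ξ.2.isPFilt_up, by rw [ξ.2.up_inter_E]; exact ξ.2.2.1⟩
  left_inv F := Subtype.ext (F.2.1.up_inter_E F.2.2)
  right_inv ξ := Subtype.ext ξ.2.up_inter_E

theorem continuous_idempotentFilterEquiv : Continuous (idempotentFilterEquiv S) := by
  refine continuous_generateFrom_iff.2 ?_
  rintro _ ⟨e, X, he, hX, hXe, rfl⟩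
  refine ⟨{F : PFilt S | e ∈ F.1 ∧ F.1 ∩ X = ∅},
    TopologicalSpace.isOpen_generateFrom_of_mem ⟨e, X, hX, ?_, rfl⟩, ?_⟩
  · intro f hf
    exact (sle_iff_of_mem_E (hXe hf).1 e).2 (hXe hf).2
  · ext F
    have hEX : E S ∩ X = X := Set.inter_eq_right.2 fun f hf => (hXe hf).1
    change e ∈ F.1 ∧ F.1 ∩ X = ∅ ↔ e ∈ F.1 ∩ E S ∧ F.1 ∩ E S ∩ X = ∅
    rw [Set.inter_assoc, hEX]
    exact ⟨fun h => ⟨⟨h.1, he⟩, h.2⟩, fun h => ⟨h.1.1, h.2⟩⟩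

/-- If `e ≤ s` lies in the `E`-filter `ξ`, then membership of `t ≤ s` in `↑ξ` is detected by an
idempotent below `e`. -/
theorem IsEFilt.mem_up_iff {ξ : Set S} (hξ : IsEFilt ξ) {e s t : S} (he : e ∈ ξ) (hes : sle e s)
    (hts : sle t s) : t ∈ up ξ ↔ e * (t * t⁻¹) ∈ ξ := by
  have heE := hξ.1 he
  have hg := mul_inv_mem_E t
  constructor
  · rintro ⟨a, ha, hat⟩
    obtain ⟨f, hf, hfe, hfa⟩ := hξ.2.2.2.1 e he a ha
    have hfE := hξ.1 hf
    have hft : f = f * t := (sle_iff_of_mem_E hfE t).1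
      (sle_trans ((sle_iff_of_mem_E hfE a).2 hfa) hat)
    have hfg : f * (t * t⁻¹) = f :=
      calc f * (t * t⁻¹) = t * t⁻¹ * (f * t) := by rw [← hft, mul_comm_of_mem_E hfE hg]
        _ = f * t := by rw [← mul_assoc, ← mul_comm_of_mem_E hfE hg, mul_assoc, mul_inv_mul]
        _ = f := hft.symm
    refine hξ.mem_of_ele hf (mul_mem_E heE hg) ?_
    change f = f * (e * (t * t⁻¹))
    rw [← mul_assoc, ← show f = f * e from hfe, hfg]
  · intro h
    refine ⟨_, h, (sle_iff_of_mem_E (hξ.1 h) t).2 ?_⟩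
    calc e * (t * t⁻¹) = t * t⁻¹ * (e * s) := by
          rw [← (sle_iff_of_mem_E heE s).1 hes, mul_comm_of_mem_E heE hg]
      _ = e * (t * t⁻¹ * s) := by rw [← mul_assoc, ← mul_comm_of_mem_E heE hg, mul_assoc]
      _ = e * t := by rw [← show t = t * t⁻¹ * s from hts]
      _ = e * (t * t⁻¹) * t := by rw [mul_assoc, mul_inv_mul]

theorem continuous_idempotentFilterEquiv_symm : Continuous (idempotentFilterEquiv S).symm := by
  refine continuous_induced_rng.2 (continuous_generateFrom_iff.2 ?_)
  rintro _ ⟨s, T, hT, hTs, rfl⟩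
  have key : ((fun F : IPFilt S => (⟨F.1, F.2.1⟩ : PFilt S)) ∘ (idempotentFilterEquiv S).symm) ⁻¹'
      {F : PFilt S | s ∈ F.1 ∧ F.1 ∩ T = ∅} =
      ⋃ e ∈ {e : S | e ∈ E S ∧ sle e s},
        {ξ : EFilt S | e ∈ ξ.1 ∧ ξ.1 ∩ (fun t => e * (t * t⁻¹)) '' T = ∅} := by
    ext ξ
    change s ∈ up ξ.1 ∧ up ξ.1 ∩ T = ∅ ↔ _
    simp only [Set.mem_iUnion, Set.mem_ofPred_eq, exists_prop, Set.eq_empty_iff_forall_notMem,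
      Set.mem_inter_iff, not_and, Set.mem_image]
    constructor
    · rintro ⟨⟨e, he, hes⟩, h⟩
      refine ⟨e, ⟨ξ.2.1 he, hes⟩, he, ?_⟩
      rintro x hx ⟨t, ht, rfl⟩
      exact h t ((ξ.2.mem_up_iff he hes (hTs ht)).2 hx) ht
    · rintro ⟨e, ⟨-, hes⟩, he, h⟩
      exact ⟨⟨e, he, hes⟩, fun t htξ ht =>
        h _ ((ξ.2.mem_up_iff he hes (hTs ht)).1 htξ) ⟨t, ht, rfl⟩⟩
  rw [key]
  refine isOpen_biUnion fun e he => TopologicalSpace.isOpen_generateFrom_of_mem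
    ⟨e, _, he.1, hT.image _, ?_, rfl⟩
  rintro _ ⟨t, -, rfl⟩
  refine ⟨mul_mem_E he.1 (mul_inv_mem_E t), ?_⟩
  change e * (t * t⁻¹) = e * (t * t⁻¹) * e
  rw [mul_assoc, ← mul_comm_of_mem_E he.1 (mul_inv_mem_E t), ← mul_assoc e e,
    show e * e = e from he.1]

end

end InvSemigroupWithZero

/-- `ε(F) = F ∩ E` is a homeomorphism from the idempotent proper filters
(with the subspace patch topology) onto the `E`-filters (with the patch topology). -/
theorem stmt_2 {S : Type*} [InvSemigroupWithZero S] :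
    ∃ h : IPFilt S ≃ₜ EFilt S, ∀ F : IPFilt S, (h F).1 = F.1 ∩ E S :=
  ⟨{ idempotentFilterEquiv S with
      continuous_toFun := continuous_idempotentFilterEquiv
      continuous_invFun := continuous_idempotentFilterEquiv_symm }, fun _ => rfl⟩
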